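/- Let H be a graph that is 3-connected or isomorphic to K_3, and let q, d ≥ 2 be integers. Then there exists a negative signal sender S^−(q, H, d) and there exists a positive signal sender S^+(q, H, d). -/

import Mathlib

open SimpleGraph

/-- The colouring `c` contains a copy of `H` in `G` all of whose edges have colour `i`. -/
def HasMonoCopyColor {V W : Type*} (G : SimpleGraph V) (H : SimpleGraph W) {q : ℕ}
    (c : Sym2 V → Fin q) (i : Fin q) : Prop :=
  ∃ f : W ↪ V, ∀ a b, H.Adj a b → G.Adj (f a) (f b) ∧ c s(f a, f b) = i

/-- The colouring `c` contains a monochromatic copy of `H` in `G`. -/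
def HasMonoCopy {V W : Type*} (G : SimpleGraph V) (H : SimpleGraph W) {q : ℕ}
    (c : Sym2 V → Fin q) : Prop :=
  ∃ i : Fin q, HasMonoCopyColor G H c i

/-- `G` is `q`-Ramsey for `H`: every `q`-colouring of the edges of `G` contains a
monochromatic copy of `H`. -/
def IsRamsey (q : ℕ) {V W : Type*} (G : SimpleGraph V) (H : SimpleGraph W) : Prop :=
  ∀ c : Sym2 V → Fin q, HasMonoCopy G H c

/-- `H` is 3-connected: it has at least 4 vertices and deleting any set of at most
2 vertices leaves a connected graph. -/
def ThreeConnected {V : Type*} [Fintype V] (H : SimpleGraph V) : Prop :=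
  4 ≤ Fintype.card V ∧
    ∀ S : Finset V, S.card ≤ 2 → (H.induce ((↑S : Set V)ᶜ)).Connected

/-- `H` is 3-connected or isomorphic to `K₃`. -/
def ThreeConnOrK3 {V : Type*} [Fintype V] (H : SimpleGraph V) : Prop :=
  ThreeConnected H ∨ Nonempty (H ≃g (⊤ : SimpleGraph (Fin 3)))

section SparseHypergraphs

variable {I I' J K K' W W' : Type}

/-- The position `k` of the edge `φ i` is a vertex of another edge indexed by `F`. -/
def SharedAt (φ : I → K → W) (F : Finset I) (i : I) (k : K) : Prop :=
  ∃ j ∈ F, j ≠ i ∧ ∃ k', φ j k' = φ i k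

/-- The edge `φ i` meets the union of the other edges indexed by `F` in at most one position. -/
def IsLeafIn (φ : I → K → W) (F : Finset I) (i : I) : Prop :=
  ∀ k l, SharedAt φ F i k → SharedAt φ F i l → k = l

/-- Any family of between two and `g` edges of the hypergraph `φ` contains two leaves. -/
def IsSparse (g : ℕ) (φ : I → K → W) : Prop :=
  ∀ F : Finset I, 2 ≤ F.card → F.card ≤ g →
    ∃ i ∈ F, ∃ j ∈ F, i ≠ j ∧ IsLeafIn φ F i ∧ IsLeafIn φ F j

lemma IsSparse.mono {g g' : ℕ} {φ : I → K → W} (h : IsSparse g φ) (hg : g' ≤ g) :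
    IsSparse g' φ := fun F h2 hF => h F h2 (hF.trans hg)

lemma IsSparse.of_map {g : ℕ} {φ : I → K → W} (h : IsSparse g φ) {φ' : I' → K → W'}
    (σ : I' ↪ I) (π : W' → W) (hπ : ∀ i k, π (φ' i k) = φ (σ i) k) : IsSparse g φ' := by
  intro F h2 hF
  have key : ∀ i, IsLeafIn φ (F.map σ) (σ i) → IsLeafIn φ' F i := by
    intro i hi
    have aux : ∀ k, SharedAt φ' F i k → SharedAt φ (F.map σ) (σ i) k := by
      rintro k ⟨j, hj, hji, k', hk'⟩
      exact ⟨σ j, Finset.mem_map_of_mem _ hj, fun e => hji (σ.injective e), k', by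
        rw [← hπ, ← hπ, hk']⟩
    exact fun k k' hk hk' => hi k k' (aux k hk) (aux k' hk')
  obtain ⟨i, hi, j, hj, hij, li, lj⟩ := h (F.map σ) (by simpa using h2) (by simpa using hF)
  obtain ⟨i, hi', rfl⟩ := Finset.mem_map.1 hi
  obtain ⟨j, hj', rfl⟩ := Finset.mem_map.1 hj
  exact ⟨i, hi', j, hj', fun e => hij (by rw [e]), key i li, key j lj⟩

lemma IsSparse.pair {g : ℕ} {φ : I → K → W} (h : IsSparse g φ) (hg : 2 ≤ g)
    (hφ : ∀ i, Function.Injective (φ i)) {i j : I} (hij : i ≠ j) {k k' l l' : K}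
    (h₁ : φ i k = φ j l) (h₂ : φ i k' = φ j l') : k = k' ∧ l = l' := by
  classical
  obtain ⟨a, ha, b, hb, hab, la, lb⟩ := h {i, j} (by rw [Finset.card_pair hij])
    (by rwa [Finset.card_pair hij])
  have hor : IsLeafIn φ {i, j} i ∨ IsLeafIn φ {i, j} j := by
    rcases Finset.mem_insert.1 ha with rfl | ha
    · exact Or.inl la
    · rw [Finset.mem_singleton] at ha
      subst ha
      exact Or.inr la
  rcases hor with hl | hl
  · have := hl k k' ⟨j, by simp, hij.symm, l, h₁.symm⟩ ⟨j, by simp, hij.symm, l', h₂.symm⟩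
    exact ⟨this, hφ j (by rw [← h₁, ← h₂, this])⟩
  · have := hl l l' ⟨i, by simp, hij, k, h₁⟩ ⟨i, by simp, hij, k', h₂⟩
    exact ⟨hφ i (by rw [h₁, h₂, this]), this⟩

open Classical in
/-- One copy of `φ` for each edge of `φ'`, the vertices in `D` being identified with the vertices
of that edge. -/
noncomputable def amalgam {D : W → Prop} (φ' : I' → {w // D w} → W') (φ : I → K → W)
    (p : I' × I) (k : K) : W' ⊕ (I' × W) :=
  if h : D (φ p.2 k) then Sum.inl (φ' p.1 ⟨_, h⟩) else Sum.inr (p.1, φ p.2 k)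

lemma amalgam_eq_same {D : W → Prop} {φ' : I' → {w // D w} → W'} {φ : I → K → W}
    (hφ' : ∀ j, Function.Injective (φ' j)) {j : I'} {i i' : I} {k k' : K}
    (h : amalgam φ' φ (j, i') k' = amalgam φ' φ (j, i) k) : φ i' k' = φ i k := by
  unfold amalgam at h
  split_ifs at h with h₁ h₂ h₂
  · simpa using hφ' j (Sum.inl.inj h)
  · simpa using h

lemma amalgam_eq_ne {D : W → Prop} {φ' : I' → {w // D w} → W'} {φ : I → K → W}
    {p p' : I' × I} {k k' : K} (hp : p'.1 ≠ p.1)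
    (h : amalgam φ' φ p' k' = amalgam φ' φ p k) :
    ∃ (h' : D (φ p'.2 k')) (h : D (φ p.2 k)), φ' p'.1 ⟨_, h'⟩ = φ' p.1 ⟨_, h⟩ := by
  unfold amalgam at h
  split_ifs at h with h₁ h₂ h₂
  · exact ⟨h₁, h₂, Sum.inl.inj h⟩
  · exact absurd (congrArg Prod.fst (Sum.inr.inj h)) hp

lemma SharedAt.of_amalgam {D : W → Prop} {φ' : I' → {w // D w} → W'} {φ : I → K → W}
    (hφ' : ∀ j, Function.Injective (φ' j)) {F : Finset (I' × I)} {J : Finset I'}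
    (hJ : ∀ p ∈ F, p.1 ∈ J) {j : I'} {Fj : Finset I} (hFj : ∀ i, i ∈ Fj ↔ (j, i) ∈ F)
    {i : I} {k : K} (h : SharedAt (amalgam φ' φ) F (j, i) k) :
    SharedAt φ Fj i k ∨ ∃ h : D (φ i k), SharedAt φ' J j ⟨_, h⟩ := by
  obtain ⟨⟨j', i'⟩, hp, hne, k', hk'⟩ := h
  by_cases hj : j' = j
  · subst hj
    exact Or.inl ⟨i', (hFj _).2 hp, fun e => hne (by rw [e]), k', amalgam_eq_same hφ' hk'⟩
  · obtain ⟨h', h, e⟩ := amalgam_eq_ne (p := (j, i)) (p' := (j', i')) hj hk'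
    exact Or.inr ⟨h, j', hJ _ hp, hj, _, e⟩

lemma IsSparse.amalgam {g : ℕ} {D : W → Prop} {φ' : I' → {w // D w} → W'} {φ : I → K → W}
    (hφ' : ∀ j, Function.Injective (φ' j)) (hs' : IsSparse g φ') (hs : IsSparse (g + 1) φ)
    (hD : ∀ i k k', D (φ i k) → D (φ i k') → k = k') : IsSparse (g + 1) (amalgam φ' φ) := by
  classical
  intro F h2 hF
  set J := F.image Prod.fst with hJdef
  have hJ : ∀ p ∈ F, p.1 ∈ J := fun p hp => Finset.mem_image_of_mem _ hp
  let fib : I' → Finset I := fun j => (F.filter (fun p => p.1 = j)).image Prod.snd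
  have hfib : ∀ j i, i ∈ fib j ↔ (j, i) ∈ F := by
    intro j i
    simp [fib]
  have hfibcard : ∀ j, (fib j).card ≤ F.card := fun j =>
    Finset.card_image_le.trans (Finset.card_filter_le _ _)
  have key : ∀ j ∈ J, ((fib j).card ≤ 1 ∨ IsLeafIn φ' J j) →
      ∃ i, (j, i) ∈ F ∧ IsLeafIn (_root_.amalgam φ' φ) F (j, i) := by
    intro j hj hor
    by_cases h1 : (fib j).card ≤ 1
    · obtain ⟨⟨j', i⟩, hp, rfl⟩ := Finset.mem_image.1 hj
      refine ⟨i, hp, fun k k' hk hk' => ?_⟩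
      have aux : ∀ k, SharedAt (_root_.amalgam φ' φ) F (j', i) k → D (φ i k) := by
        intro k hk
        rcases hk.of_amalgam hφ' hJ (hfib _) with ⟨i', hi', hne, -⟩ | ⟨h, -⟩
        · exact absurd (Finset.card_le_one.1 h1 i' hi' i ((hfib _ _).2 hp)) hne
        · exact h
      exact hD i k k' (aux k hk) (aux k' hk')
    · have hl := hor.resolve_left h1
      obtain ⟨i₁, hi₁, i₂, hi₂, hne, l₁, l₂⟩ := hs (fib j) (by omega) ((hfibcard j).trans hF)
      by_contra! hcon
      have aux : ∀ i ∈ fib j, IsLeafIn φ (fib j) i →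
          ∃ k, ¬ SharedAt φ (fib j) i k ∧ ∃ h : D (φ i k), SharedAt φ' J j ⟨_, h⟩ := by
        intro i hi hli
        have := hcon i ((hfib _ _).1 hi)
        unfold IsLeafIn at this
        push Not at this
        obtain ⟨k, k', hk, hk', hkk⟩ := this
        have a := hk.of_amalgam hφ' hJ (hfib j)
        have a' := hk'.of_amalgam hφ' hJ (hfib j)
        by_cases b : SharedAt φ (fib j) i k
        · by_cases b' : SharedAt φ (fib j) i k'
          · exact absurd (hli k k' b b') hkk
          · exact ⟨k', b', a'.resolve_left b'⟩
        · exact ⟨k, b, a.resolve_left b⟩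
      obtain ⟨k₁, n₁, h₁, s₁⟩ := aux i₁ hi₁ l₁
      obtain ⟨k₂, n₂, h₂, s₂⟩ := aux i₂ hi₂ l₂
      have := hl _ _ s₁ s₂
      exact n₁ ⟨i₂, hi₂, hne.symm, k₂, (congrArg Subtype.val this).symm⟩
  rcases Nat.lt_or_ge J.card 2 with hJ2 | hJ2
  · have hne : F.Nonempty := Finset.card_pos.1 (by omega)
    obtain ⟨⟨j, i₀⟩, hp⟩ := hne
    have hall : ∀ p ∈ F, p.1 = j := fun p hp' =>
      Finset.card_le_one.1 (by omega) _ (hJ p hp') _ (hJ _ hp)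
    have hcard : (fib j).card = F.card := by
      have : F.filter (fun p => p.1 = j) = F := Finset.filter_true_of_mem hall
      simp only [fib, this]
      apply Finset.card_image_of_injOn
      intro p hp p' hp' e
      exact Prod.ext ((hall p hp).trans (hall p' hp').symm) e
    obtain ⟨i₁, hi₁, i₂, hi₂, hne, l₁, l₂⟩ := hs (fib j) (by omega) (by omega)
    have aux : ∀ i, IsLeafIn φ (fib j) i → IsLeafIn (_root_.amalgam φ' φ) F (j, i) := by
      intro i hli
      have aux : ∀ k, SharedAt (_root_.amalgam φ' φ) F (j, i) k → SharedAt φ (fib j) i k := by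
        intro k hk
        rcases hk.of_amalgam hφ' hJ (hfib _) with h | ⟨h, j', hj', hne, -⟩
        · exact h
        · obtain ⟨p, hp, rfl⟩ := Finset.mem_image.1 hj'
          exact absurd (hall p hp) hne
      exact fun k k' hk hk' => hli k k' (aux k hk) (aux k' hk')
    exact ⟨(j, i₁), (hfib _ _).1 hi₁, (j, i₂), (hfib _ _).1 hi₂, by simpa using hne,
      aux _ l₁, aux _ l₂⟩
  · have : ∃ j₁ ∈ J, ∃ j₂ ∈ J, j₁ ≠ j₂ ∧ ((fib j₁).card ≤ 1 ∨ IsLeafIn φ' J j₁) ∧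
        ((fib j₂).card ≤ 1 ∨ IsLeafIn φ' J j₂) := by
      rcases Nat.lt_or_ge g J.card with hJg | hJg
      · have hinj : Set.InjOn Prod.fst (F : Set (I' × I)) := by
          apply Finset.injOn_of_card_image_eq
          have : J.card ≤ F.card := Finset.card_image_le
          change J.card = F.card
          omega
        have hone : ∀ j, (fib j).card ≤ 1 := by
          intro j
          rw [Finset.card_le_one]
          intro a ha b hb
          exact congrArg Prod.snd (hinj ((hfib _ _).1 ha) ((hfib _ _).1 hb) rfl)
        obtain ⟨j₁, h₁, j₂, h₂, hne⟩ := Finset.one_lt_card.1 (show 1 < J.card by omega)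
        exact ⟨j₁, h₁, j₂, h₂, hne, Or.inl (hone _), Or.inl (hone _)⟩
      · obtain ⟨j₁, h₁, j₂, h₂, hne, l₁, l₂⟩ := hs' J hJ2 hJg
        exact ⟨j₁, h₁, j₂, h₂, hne, Or.inr l₁, Or.inr l₂⟩
    obtain ⟨j₁, h₁, j₂, h₂, hne, l₁, l₂⟩ := this
    obtain ⟨i₁, m₁, leaf₁⟩ := key j₁ h₁ l₁
    obtain ⟨i₂, m₂, leaf₂⟩ := key j₂ h₂ l₂
    exact ⟨_, m₁, _, m₂, fun e => hne (congrArg Prod.fst e), leaf₁, leaf₂⟩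

/-- There is a finite `K`-uniform hypergraph without small dense configurations such that every
`q`-colouring of its vertices has a monochromatic edge. -/
def HasSparseMono (q g : ℕ) (K : Type) : Prop :=
  ∃ (W I : Type) (_ : Finite W) (_ : Finite I) (φ : I → K → W),
    (∀ i, Function.Injective (φ i)) ∧ IsSparse g φ ∧
      ∀ col : W → Fin q, ∃ i, ∀ k k', col (φ i k) = col (φ i k')

lemma hasSparseMono_one (q : ℕ) (K : Type) [Finite K] : HasSparseMono q 1 K := by
  classical
  have := Fintype.ofFinite K
  refine ⟨Fin (q * Fintype.card K + 1), K ↪ Fin (q * Fintype.card K + 1), inferInstance,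
    inferInstance, fun e => e, fun e => e.injective, fun F h2 h1 => by omega, fun col => ?_⟩
  obtain ⟨y, hy⟩ := Fintype.exists_lt_card_fiber_of_mul_lt_card col (n := Fintype.card K)
    (by simp)
  rw [← Fintype.card_subtype] at hy
  obtain ⟨e⟩ := Function.Embedding.nonempty_of_card_le hy.le
  refine ⟨e.trans (Function.Embedding.subtype _), fun k k' => ?_⟩
  exact (e k).2.trans (e k').2.symm

lemma exists_amalgam_sparse {q g : ℕ} (hq : 0 < q)
    (hg : ∀ (K : Type) [Finite K], HasSparseMono q g K) {K W₀ I₀ : Type} [Finite K] [Finite I₀]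
    (φ₀ : I₀ → K → W₀) (hφ₀ : ∀ i, Function.Injective (φ₀ i))
    (hcol : ∀ col : W₀ → Fin q, ∃ i, ∀ k k', col (φ₀ i k) = col (φ₀ i k')) (S : Finset W₀) :
    ∃ (W I : Type) (_ : Finite W) (_ : Finite I) (φ : I → K → W) (π : W → W₀) (τ : I → I₀),
      (∀ i k, π (φ i k) = φ₀ (τ i) k) ∧ IsSparse (g + 1) φ ∧
      ∀ col : W → Fin q, (∀ w w', π w = π w' → π w ∉ S → col w = col w') →
        ∃ i, ∀ k k', col (φ i k) = col (φ i k') := by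
  classical
  induction S using Finset.induction_on with
  | empty =>
    refine ⟨I₀ × K, I₀, inferInstance, inferInstance, fun i k => (i, k), fun p => φ₀ p.1 p.2, id,
      fun i k => rfl, ?_, ?_⟩
    · intro F h2 _
      obtain ⟨i, hi, j, hj, hij⟩ := Finset.one_lt_card.1 (show 1 < F.card by omega)
      have : ∀ i, IsLeafIn (fun (i : I₀) (k : K) => (i, k)) F i := by
        rintro i k k' ⟨j, -, hj, l, hl⟩ -
        exact absurd (congrArg Prod.fst hl) hj
      exact ⟨i, hi, j, hj, hij, this i, this j⟩
    · intro col hc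
      obtain ⟨i, hi⟩ := hcol (fun x => if h : ∃ p : I₀ × K, φ₀ p.1 p.2 = x
        then col h.choose else ⟨0, hq⟩)
      refine ⟨i, fun k k' => ?_⟩
      have aux : ∀ k, (if h : ∃ p : I₀ × K, φ₀ p.1 p.2 = φ₀ i k
          then col h.choose else ⟨0, hq⟩) = col (i, k) := by
        intro k
        have h : ∃ p : I₀ × K, φ₀ p.1 p.2 = φ₀ i k := ⟨(i, k), rfl⟩
        rw [dif_pos h]
        exact hc _ _ h.choose_spec (by simp)
      rw [← aux k, ← aux k', hi k k']
  | insert x S hx ih =>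
    obtain ⟨W, I, _, _, φ, π, τ, hπ, hs, hmono⟩ := ih
    obtain ⟨W', I', _, _, φ', hφ', hs', hmono'⟩ := hg {w // π w = x}
    refine ⟨W' ⊕ (I' × W), I' × I, inferInstance, inferInstance, amalgam φ' φ,
      Sum.elim (fun _ => x) (fun p => π p.2), fun p => τ p.2, ?_, ?_, ?_⟩
    · intro p k
      unfold amalgam
      split_ifs with h
      · simp [← hπ, h]
      · simp [hπ]
    · apply IsSparse.amalgam hφ' hs' hs
      intro i k k' h h'
      rw [hπ] at h h'
      exact hφ₀ _ (h.trans h'.symm)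
    · intro col hc
      obtain ⟨j, hj⟩ := hmono' (fun w => col (Sum.inl w))
      obtain ⟨i, hi⟩ := hmono (fun w => if h : π w = x then col (Sum.inl (φ' j ⟨w, h⟩))
        else col (Sum.inr (j, w))) (by
          intro w w' hww hw
          by_cases h : π w = x
          · have h' : π w' = x := hww ▸ h
            simp only [h, h', dif_pos]
            exact hj _ _
          · have h' : ¬ π w' = x := hww ▸ h
            simp only [h, h', dif_neg, not_false_eq_true]
            exact hc _ _ (by simpa using hww) (by simp [h, hw]))
      refine ⟨(j, i), fun k k' => ?_⟩
      have aux : ∀ k, col (amalgam φ' φ (j, i) k) = if h : π (φ i k) = x then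
          col (Sum.inl (φ' j ⟨_, h⟩)) else col (Sum.inr (j, φ i k)) := by
        intro k
        unfold amalgam
        split_ifs <;> rfl
      rw [aux, aux]
      exact hi k k'

theorem hasSparseMono (q g : ℕ) (hq : 0 < q) (K : Type) [Finite K] : HasSparseMono q g K := by
  classical
  induction g generalizing K with
  | zero =>
    obtain ⟨W, I, h₁, h₂, φ, h, hs, hm⟩ := hasSparseMono_one q K
    exact ⟨W, I, h₁, h₂, φ, h, hs.mono (by omega), hm⟩
  | succ g ih =>
    obtain ⟨W₀, I₀, _, _, φ₀, hφ₀, -, hcol⟩ := hasSparseMono_one q K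
    have := Fintype.ofFinite W₀
    obtain ⟨W, I, h₁, h₂, φ, π, τ, hπ, hs, hm⟩ :=
      exists_amalgam_sparse hq (fun K _ => ih K) φ₀ hφ₀ hcol Finset.univ
    refine ⟨W, I, h₁, h₂, φ, fun i k k' h => ?_, hs, fun col => hm col (by simp)⟩
    exact hφ₀ (τ i) (by rw [← hπ, ← hπ, h])

end SparseHypergraphs

section Constraints

lemma Finset.exists_insert_step {α : Type*} [DecidableEq α] (P : Finset α → Prop) (h₀ : P ∅)
    {T : Finset α} (hT : ¬ P T) : ∃ F a, a ∉ F ∧ P F ∧ ¬ P (insert a F) := by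
  by_contra! h
  exact hT (Finset.induction_on T h₀ fun a s ha hs => h s a ha hs)

/-- A satisfiable constraint without constant solutions can be repeated along a sparse hypergraph
so that the resulting system is satisfiable and separates two covered vertices. -/
lemma exists_sparse_forced_ne {q : ℕ} (hq : 0 < q) (g : ℕ) {K : Type} [Finite K]
    (T : (K → Fin q) → Prop) (hT : ∃ s, T s) (hconst : ∀ s, T s → ¬ ∀ k k', s k = s k') :
    ∃ (W I : Type) (_ : Finite W) (_ : Finite I) (φ : I → K → W) (x y : W),
      (∀ i, Function.Injective (φ i)) ∧ IsSparse g φ ∧ (∃ i k, φ i k = x) ∧ (∃ i k, φ i k = y) ∧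
      (∃ s : W → Fin q, ∀ i, T (s ∘ φ i)) ∧
      ∀ s : W → Fin q, (∀ i, T (s ∘ φ i)) → s x ≠ s y := by
  classical
  obtain ⟨W, I, _, _, φ, hφ, hs, hm⟩ := hasSparseMono q g hq K
  have := Fintype.ofFinite I
  have := Fintype.ofFinite K
  obtain ⟨t, ht⟩ := hT
  obtain ⟨F, i₀, hi₀, ⟨s₀, hs₀⟩, hF'⟩ := Finset.exists_insert_step
    (fun F : Finset I => ∃ s : W → Fin q, ∀ i ∈ F, T (s ∘ φ i)) ⟨fun _ => ⟨0, hq⟩, by simp⟩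
    (T := Finset.univ) (by
      rintro ⟨s, h⟩
      obtain ⟨i, hi⟩ := hm s
      exact hconst _ (h i (Finset.mem_univ i)) hi)
  let ψ : Finset K → Option {i // i ∈ F} → K → W ⊕ K := fun S o =>
    o.elim (fun k => if k ∈ S then Sum.inl (φ i₀ k) else Sum.inr k) fun i k => Sum.inl (φ i k)
  obtain ⟨S, k₀, hk₀, hS, hS'⟩ := Finset.exists_insert_step
    (fun S : Finset K => ∃ s : W ⊕ K → Fin q, ∀ o, T (s ∘ ψ S o))
    ⟨Sum.elim s₀ t, by
      rintro (_ | i)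
      · exact ht
      · exact hs₀ i i.2⟩
    (T := Finset.univ) (by
      rintro ⟨s, h⟩
      refine hF' ⟨s ∘ Sum.inl, fun i hi => ?_⟩
      rcases Finset.mem_insert.1 hi with rfl | hi
      · simpa [ψ, Function.comp_def] using h none
      · exact h (some ⟨i, hi⟩))
  have hforced : ∀ s : W ⊕ K → Fin q, (∀ o, T (s ∘ ψ S o)) →
      s (Sum.inl (φ i₀ k₀)) ≠ s (Sum.inr k₀) := by
    intro s h e
    refine hS' ⟨s, ?_⟩
    rintro (_ | i)
    · have : s ∘ ψ (insert k₀ S) none = s ∘ ψ S none := by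
        funext k
        by_cases hk : k = k₀
        · subst hk
          simp [ψ, hk₀, e]
        · simp [ψ, hk]
      rw [this]
      exact h none
    · exact h (some i)
  have hinj : ∀ o, Function.Injective (ψ S o) := by
    rintro (_ | i) k k' h
    · simp only [ψ, Option.elim] at h
      split_ifs at h
      · exact hφ _ (Sum.inl.inj h)
      · exact Sum.inr.inj h
    · exact hφ _ (Sum.inl.inj h)
  refine ⟨W ⊕ K, Option {i // i ∈ F}, inferInstance, inferInstance, ψ S, Sum.inl (φ i₀ k₀),
    Sum.inr k₀, hinj, ?_, ?_, ⟨none, k₀, by simp [ψ, hk₀]⟩, hS, hforced⟩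
  · refine hs.of_map ⟨fun o => o.elim i₀ Subtype.val, ?_⟩ (Sum.elim id (φ i₀)) ?_
    · rintro (_ | i) (_ | j) h
      · rfl
      · exact absurd j.2 (by simpa [← show i₀ = j from h] using hi₀)
      · exact absurd i.2 (by simpa [show (i : I) = i₀ from h] using hi₀)
      · exact congrArg some (Subtype.ext h)
    · rintro (_ | i) k
      · simp only [ψ, Option.elim]
        split_ifs <;> rfl
      · rfl
  · by_contra! hcov
    obtain ⟨s, h⟩ := hS
    refine hforced (Function.update s (Sum.inl (φ i₀ k₀)) (s (Sum.inr k₀))) (fun o => ?_)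
      (by simp)
    have : Function.update s (Sum.inl (φ i₀ k₀)) (s (Sum.inr k₀)) ∘ ψ S o = s ∘ ψ S o := by
      funext k
      exact Function.update_of_ne (hcov o k) _ _
    rw [this]
    exact h o

/-- Inequality constraints along a sparse graph can force two covered vertices to be equal. -/
lemma exists_sparse_forced_eq {q : ℕ} (hq : 2 ≤ q) (g : ℕ) :
    ∃ (W I : Type) (_ : Finite W) (_ : Finite I) (φ : I → Bool → W) (x y : W),
      (∀ i, Function.Injective (φ i)) ∧ IsSparse g φ ∧ x ≠ y ∧ (∃ i k, φ i k = x) ∧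
      (∃ i k, φ i k = y) ∧ (∃ s : W → Fin q, ∀ i, s (φ i false) ≠ s (φ i true)) ∧
      ∀ s : W → Fin q, (∀ i, s (φ i false) ≠ s (φ i true)) → s x = s y := by
  classical
  obtain ⟨W, I, _, _, φ, hφ, hs, hm⟩ := hasSparseMono q g (by omega) Bool
  have := Fintype.ofFinite I
  have : Nontrivial (Fin q) := Fin.nontrivial_iff_two_le.2 hq
  obtain ⟨F, i₀, hi₀, hsat, hF'⟩ := Finset.exists_insert_step
    (fun F : Finset I => ∃ s : W → Fin q, ∀ i ∈ F, s (φ i false) ≠ s (φ i true))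
    ⟨fun _ => ⟨0, by omega⟩, by simp⟩
    (T := Finset.univ) (by
      rintro ⟨s, h⟩
      obtain ⟨i, hi⟩ := hm s
      exact h i (Finset.mem_univ i) (hi _ _))
  have hforced : ∀ s : W → Fin q, (∀ i ∈ F, s (φ i false) ≠ s (φ i true)) →
      s (φ i₀ false) = s (φ i₀ true) := by
    intro s h
    by_contra hne
    refine hF' ⟨s, fun i hi => ?_⟩
    rcases Finset.mem_insert.1 hi with rfl | hi
    · exact hne
    · exact h i hi
  have hxy : ∀ b b', b ≠ b' → φ i₀ b ≠ φ i₀ b' := fun b b' h e => h (hφ _ e)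
  have hcov : ∀ b b', b ≠ b' → ∃ (i : {i // i ∈ F}) (k : Bool), φ i k = φ i₀ b := by
    intro b b' hb
    by_contra! hcov
    obtain ⟨s, h⟩ := hsat
    obtain ⟨t, ht⟩ := exists_ne (s (φ i₀ b'))
    have e : ∀ b b', b ≠ b' → (Function.update s (φ i₀ b) t) (φ i₀ b') = s (φ i₀ b') :=
      fun b b' h => Function.update_of_ne (hxy b' b h.symm) _ _
    have := hforced (Function.update s (φ i₀ b) t) (fun i hi => by
      rw [Function.update_of_ne (hcov ⟨i, hi⟩ _), Function.update_of_ne (hcov ⟨i, hi⟩ _)]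
      exact h i hi)
    have h2 : Function.update s (φ i₀ b) t (φ i₀ b) = Function.update s (φ i₀ b) t (φ i₀ b') := by
      cases b <;> cases b' <;> first | exact absurd rfl hb | exact this | exact this.symm
    rw [e b b' hb, Function.update_self] at h2
    exact ht h2
  obtain ⟨s, h⟩ := hsat
  refine ⟨W, {i // i ∈ F}, inferInstance, inferInstance, fun i => φ i, φ i₀ false, φ i₀ true,
    fun i => hφ i, hs.of_map (Function.Embedding.subtype _) id fun _ _ => rfl,
    hxy _ _ (by simp), hcov false true (by simp), hcov true false (by simp),
    ⟨s, fun i => h i i.2⟩, fun s h => hforced s fun i hi => h ⟨i, hi⟩⟩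

end Constraints

section Gluing

variable {VH V Z I : Type} {H : SimpleGraph VH} {q : ℕ}

lemma HasMonoCopy.of_hom {X : SimpleGraph V} {Y : SimpleGraph Z} (ψ : V ↪ Z)
    (hψ : ∀ x y, X.Adj x y → Y.Adj (ψ x) (ψ y)) {c : Sym2 Z → Fin q}
    (h : HasMonoCopy X H (fun e => c (e.map ψ))) : HasMonoCopy Y H c := by
  obtain ⟨k, f, hf⟩ := h
  exact ⟨k, f.trans ψ, fun a b hab => ⟨hψ _ _ (hf a b hab).1, (hf a b hab).2⟩⟩

variable [Fintype VH]

/-- `H` has at least three vertices and cannot be disconnected by deleting at most two. -/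
def Robust (H : SimpleGraph VH) : Prop :=
  3 ≤ Fintype.card VH ∧
    ∀ S : Finset VH, S.card ≤ 2 → (H.induce ((↑S : Set VH)ᶜ)).Preconnected

lemma ThreeConnOrK3.robust (hH : ThreeConnOrK3 H) : Robust H := by
  rcases hH with ⟨h4, h⟩ | ⟨⟨e⟩⟩
  · exact ⟨by omega, fun S hS => (h S hS).preconnected⟩
  · refine ⟨by simp [Fintype.card_congr e.toEquiv], fun S _ a b => ?_⟩
    by_cases hab : a = b
    · rw [hab]
    · refine Adj.reachable ?_
      rw [comap_adj, ← e.map_adj_iff]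
      simpa using fun h => hab (Subtype.ext h)

lemma Robust.exists_adj_ne (hH : Robust H) (a b : VH) : ∃ c, c ≠ b ∧ H.Adj a c := by
  classical
  obtain ⟨S, hS, haS, hbS⟩ : ∃ S : Finset VH, S.card ≤ 1 ∧ a ∉ S ∧ (b = a ∨ b ∈ S) := by
    by_cases hab : b = a
    · exact ⟨∅, by simp, by simp, Or.inl hab⟩
    · exact ⟨{b}, by simp, by simpa using Ne.symm hab, by simp⟩
  obtain ⟨d, hd⟩ : ∃ d, d ∉ insert a S := by
    by_contra! h
    have h1 : (insert a S).card = Fintype.card VH := by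
      rw [Finset.eq_univ_iff_forall.2 h, Finset.card_univ]
    have h2 := Finset.card_insert_le a S
    have h3 := hH.1
    omega
  rw [Finset.mem_insert, not_or] at hd
  obtain ⟨p⟩ := hH.2 S (by omega) ⟨a, by simpa using haS⟩ ⟨d, by simpa using hd.2⟩
  have hnn : ¬ p.Nil := fun h => hd.1 (congrArg Subtype.val h.eq).symm
  have hadj := p.adj_snd hnn
  refine ⟨p.snd, fun e => ?_, hadj⟩
  rcases hbS with rfl | hbS
  · exact hadj.ne (Subtype.ext e.symm)
  · exact p.snd.2 (by rw [e]; exact hbS)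

lemma Robust.exists_adj (hH : Robust H) : ∃ a b, H.Adj a b := by
  have : 0 < Fintype.card VH := by have := hH.1; omega
  obtain ⟨a⟩ := Fintype.card_pos_iff.1 this
  obtain ⟨c, -, h⟩ := hH.exists_adj_ne a a
  exact ⟨a, c, h⟩

open Classical in
lemma Robust.forall_or_forall (hH : Robust H) (A B : VH → Prop)
    (hAB : ∀ a b, H.Adj a b → (A a ∧ A b) ∨ (B a ∧ B b))
    (hcard : (Finset.univ.filter fun a => A a ∧ B a).card ≤ 2) : (∀ a, A a) ∨ ∀ a, B a := by
  by_contra! h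
  obtain ⟨⟨a, ha⟩, b, hb⟩ := h
  have hor : ∀ a, A a ∨ B a := by
    intro a
    obtain ⟨c, -, hc⟩ := hH.exists_adj_ne a a
    rcases hAB _ _ hc with h | h
    · exact Or.inl h.1
    · exact Or.inr h.1
  obtain ⟨p⟩ := hH.2 _ hcard ⟨a, by simp [ha]⟩ ⟨b, by simp [hb]⟩
  have key : ∀ {x y : ((↑(Finset.univ.filter fun a => A a ∧ B a) : Set VH)ᶜ : Set VH)},
      (H.induce _).Walk x y → ¬ A x → ¬ A y := by
    intro x y p
    induction p with
    | nil => exact id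
    | @cons u v w huv _ ih =>
      intro hu
      refine ih fun hv => ?_
      rcases hAB _ _ huv with h | h
      · exact hu h.1
      · have := v.2
        simp only [Set.mem_compl_iff, Finset.mem_coe, Finset.mem_filter, Finset.mem_univ,
          true_and, not_and] at this
        exact this hv h.2
  exact key p ha ((hor b).resolve_right hb)

/-- The piece `P i` meets the other pieces indexed by `F` in at most one vertex, or in the two ends
of an edge that it shares with one of them. -/
def IsLeafPiece (P : I → SimpleGraph Z) (F : Finset I) (i : I) : Prop :=
  ∃ z w, (∀ x ∈ (P i).support, ∀ j ∈ F, j ≠ i → x ∈ (P j).support → x = z ∨ x = w) ∧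
    (z = w ∨ (P i).Adj z w ∧ ∃ j ∈ F, j ≠ i ∧ (P j).Adj z w)

/-- Any family of between two and `m` pieces contains a leaf. -/
def IsSparseGluing (m : ℕ) (P : I → SimpleGraph Z) : Prop :=
  ∀ F : Finset I, 2 ≤ F.card → F.card ≤ m → ∃ i ∈ F, IsLeafPiece P F i

lemma exists_adj_cover_single (hH : Robust H) {m : ℕ} {P : I → SimpleGraph Z}
    (hP : IsSparseGluing m P) (f : VH ↪ Z) (F : Finset I) (hm : F.card ≤ m)
    (hf : ∀ a b, H.Adj a b → ∃ i ∈ F, (P i).Adj (f a) (f b)) :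
    ∃ i, ∀ a b, H.Adj a b → (P i).Adj (f a) (f b) := by
  classical
  induction F using Finset.strongInduction with
  | H F ih =>
  rcases Nat.lt_or_ge F.card 2 with h1 | h2
  · obtain ⟨a, b, hab⟩ := hH.exists_adj
    obtain ⟨i, hi, -⟩ := hf a b hab
    refine ⟨i, fun a b hab => ?_⟩
    obtain ⟨j, hj, h⟩ := hf a b hab
    rwa [Finset.card_le_one.1 (by omega) i hi j hj]
  · obtain ⟨i, hi, z, w, hzw, hor⟩ := hP F h2 hm
    have hcommon : ∀ a b, a ≠ b → f a ∈ (P i).support → f b ∈ (P i).support →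
        (∃ j ∈ F, j ≠ i ∧ f a ∈ (P j).support) → (∃ j ∈ F, j ≠ i ∧ f b ∈ (P j).support) →
        (P i).Adj (f a) (f b) ∧ ∃ j ∈ F, j ≠ i ∧ (P j).Adj (f a) (f b) := by
      rintro a b hab ha hb ⟨j, hj, hji, ha'⟩ ⟨k, hk, hki, hb'⟩
      have hab' : f a ≠ f b := fun e => hab (f.injective e)
      have h₁ := hzw _ ha j hj hji ha'
      have h₂ := hzw _ hb k hk hki hb'
      rcases hor with rfl | ⟨hadj, l, hl, hli, hadj'⟩
      · simp only [or_self] at h₁ h₂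
        exact absurd (h₁.trans h₂.symm) hab'
      · rcases h₁ with h₁ | h₁ <;> rcases h₂ with h₂ | h₂
        · exact absurd (h₁.trans h₂.symm) hab'
        · rw [h₁, h₂]
          exact ⟨hadj, l, hl, hli, hadj'⟩
        · rw [h₁, h₂]
          exact ⟨hadj.symm, l, hl, hli, hadj'.symm⟩
        · exact absurd (h₁.trans h₂.symm) hab'
    rcases hH.forall_or_forall (fun a => f a ∈ (P i).support)
      (fun a => ∃ j ∈ F, j ≠ i ∧ f a ∈ (P j).support) (by
        intro a b hab
        obtain ⟨j, hj, h⟩ := hf a b hab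
        by_cases hji : j = i
        · subst hji
          exact Or.inl ⟨⟨_, h⟩, ⟨_, h.symm⟩⟩
        · exact Or.inr ⟨⟨j, hj, hji, _, h⟩, ⟨j, hj, hji, _, h.symm⟩⟩) (by
        have : ((Finset.univ.filter fun a => f a ∈ (P i).support ∧
            ∃ j ∈ F, j ≠ i ∧ f a ∈ (P j).support).map f) ⊆ {z, w} := by
          intro x hx
          obtain ⟨a, ha, rfl⟩ := Finset.mem_map.1 hx
          obtain ⟨-, h, j, hj, hji, h'⟩ := Finset.mem_filter.1 ha
          simpa using hzw _ h j hj hji h'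
        have := Finset.card_le_card this
        rw [Finset.card_map] at this
        exact (le_of_eq (by congr)).trans (this.trans Finset.card_le_two)) with hA | hB
    · refine ⟨i, fun a b hab => ?_⟩
      obtain ⟨j, hj, h⟩ := hf a b hab
      by_cases hji : j = i
      · rwa [hji] at h
      · exact (hcommon a b hab.ne (hA a) (hA b) ⟨j, hj, hji, _, h⟩ ⟨j, hj, hji, _, h.symm⟩).1
    · refine ih (F.erase i) (Finset.erase_ssubset hi) ((Finset.card_erase_le).trans hm) ?_
      intro a b hab
      obtain ⟨j, hj, h⟩ := hf a b hab
      by_cases hji : j = i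
      · subst hji
        obtain ⟨-, l, hl, hli, h'⟩ := hcommon a b hab.ne ⟨_, h⟩ ⟨_, h.symm⟩ (hB a) (hB b)
        exact ⟨l, Finset.mem_erase.2 ⟨hli, hl⟩, h'⟩
      · exact ⟨j, Finset.mem_erase.2 ⟨hji, hj⟩, h⟩

lemma IsSparseGluing.exists_single (hH : Robust H) {P : I → SimpleGraph Z}
    (hP : IsSparseGluing (Fintype.card (VH × VH)) P) (f : VH ↪ Z)
    (hf : ∀ a b, H.Adj a b → ∃ i, (P i).Adj (f a) (f b)) :
    ∃ i, ∀ a b, H.Adj a b → (P i).Adj (f a) (f b) := by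
  classical
  have : ∀ e : VH × VH, ∃ i, H.Adj e.1 e.2 → (P i).Adj (f e.1) (f e.2) := by
    intro e
    by_cases he : H.Adj e.1 e.2
    · obtain ⟨i, hi⟩ := hf _ _ he
      exact ⟨i, fun _ => hi⟩
    · obtain ⟨a, b, hab⟩ := hH.exists_adj
      obtain ⟨i, -⟩ := hf a b hab
      exact ⟨i, fun h => absurd h he⟩
  choose g hg using this
  refine exists_adj_cover_single hH hP f (Finset.univ.image g) ?_ fun a b hab =>
    ⟨g (a, b), Finset.mem_image_of_mem _ (Finset.mem_univ _), hg (a, b) hab⟩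
  exact Finset.card_image_le

/-- The graph obtained by gluing the pieces `X i` along the maps `ψ i`. -/
def glue {V : I → Type} (X : ∀ i, SimpleGraph (V i)) (ψ : ∀ i, V i ↪ Z) : SimpleGraph Z :=
  ⨆ i, (X i).map (ψ i)

lemma glue_adj {V : I → Type} {X : ∀ i, SimpleGraph (V i)} {ψ : ∀ i, V i ↪ Z} {z w : Z} :
    (glue X ψ).Adj z w ↔ ∃ i x y, (X i).Adj x y ∧ ψ i x = z ∧ ψ i y = w := by
  simp [glue, iSup_adj, map_adj]

lemma glue_adj_of_adj {V : I → Type} {X : ∀ i, SimpleGraph (V i)} {ψ : ∀ i, V i ↪ Z} {i : I}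
    {x y : V i} (h : (X i).Adj x y) : (glue X ψ).Adj (ψ i x) (ψ i y) :=
  glue_adj.2 ⟨i, x, y, h, rfl, rfl⟩

lemma not_hasMonoCopy_glue (hH : Robust H) {V : I → Type} {X : ∀ i, SimpleGraph (V i)}
    {ψ : ∀ i, V i ↪ Z}
    (hP : IsSparseGluing (Fintype.card (VH × VH)) fun i => (X i).map (ψ i))
    (c : ∀ i, Sym2 (V i) → Fin q) (c' : Sym2 Z → Fin q) (hc : ∀ i, ¬ HasMonoCopy (X i) H (c i))
    (hcc : ∀ i x y, (X i).Adj x y → c' s(ψ i x, ψ i y) = c i s(x, y)) :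
    ¬ HasMonoCopy (glue X ψ) H c' := by
  rintro ⟨k, f, hf⟩
  obtain ⟨i, hi⟩ := hP.exists_single hH f fun a b hab => by
    simpa [glue, iSup_adj] using (hf a b hab).1
  have hlift : ∀ a, ∃ x, ψ i x = f a := by
    intro a
    obtain ⟨b, -, hab⟩ := hH.exists_adj_ne a a
    obtain ⟨x, y, -, hx, -⟩ := (map_adj _ _ _ _).1 (hi a b hab)
    exact ⟨x, hx⟩
  choose g hg using hlift
  refine hc i ⟨k, ⟨g, fun a b hab => f.injective (by rw [← hg, ← hg, hab])⟩, fun a b hab => ?_⟩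
  obtain ⟨x, y, hxy, hx, hy⟩ := (map_adj _ _ _ _).1 (hi a b hab)
  rw [← hg] at hx hy
  have hx := (ψ i).injective hx
  have hy := (ψ i).injective hy
  subst hx hy
  refine ⟨hxy, ?_⟩
  rw [← (hf a b hab).2, ← hg, ← hg]
  exact (hcc i _ _ hxy).symm

lemma exists_glue_colouring (hH : Robust H) (hq : 0 < q) {V : I → Type}
    {X : ∀ i, SimpleGraph (V i)} {ψ : ∀ i, V i ↪ Z}
    (hP : IsSparseGluing (Fintype.card (VH × VH)) fun i => (X i).map (ψ i))
    (c : ∀ i, Sym2 (V i) → Fin q) (hc : ∀ i, ¬ HasMonoCopy (X i) H (c i))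
    (hagree : ∀ i j, i ≠ j → ∀ x y x' y', (X i).Adj x y → (X j).Adj x' y' →
      ψ i x = ψ j x' → ψ i y = ψ j y' → c i s(x, y) = c j s(x', y')) :
    ∃ c' : Sym2 Z → Fin q, ¬ HasMonoCopy (glue X ψ) H c' ∧
      ∀ i x y, (X i).Adj x y → c' s(ψ i x, ψ i y) = c i s(x, y) := by
  classical
  let c' : Sym2 Z → Fin q := fun e =>
    if h : ∃ i, ∃ x y, (X i).Adj x y ∧ s(ψ i x, ψ i y) = e then
      c h.choose s(h.choose_spec.choose, h.choose_spec.choose_spec.choose) else ⟨0, hq⟩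
  have hcc : ∀ i x y, (X i).Adj x y → c' s(ψ i x, ψ i y) = c i s(x, y) := by
    intro i x y hxy
    have h : ∃ j, ∃ x' y', (X j).Adj x' y' ∧ s(ψ j x', ψ j y') = s(ψ i x, ψ i y) :=
      ⟨i, x, y, hxy, rfl⟩
    simp only [c', dif_pos h]
    obtain ⟨hadj, he⟩ := h.choose_spec.choose_spec.choose_spec
    revert hadj he
    generalize h.choose_spec.choose_spec.choose = y'
    generalize h.choose_spec.choose = x'
    revert x' y'
    generalize h.choose = j
    intro y' x' hadj he
    by_cases hji : j = i
    · subst hji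
      have : s(x', y') = s(x, y) := Sym2.map.injective (ψ j).injective (by simpa using he)
      rw [this]
    · rcases Sym2.eq_iff.1 he with ⟨h₁, h₂⟩ | ⟨h₁, h₂⟩
      · exact hagree j i hji _ _ _ _ hadj hxy h₁ h₂
      · rw [hagree j i hji _ _ _ _ hadj hxy.symm h₁ h₂, Sym2.eq_swap]
  exact ⟨c', not_hasMonoCopy_glue hH hP c c' hc hcc, hcc⟩

end Gluing

section StarGluing

variable {VH V K I W : Type} {H : SimpleGraph VH} {q : ℕ}

/-- Some colouring of `X` without monochromatic copy of `H` gives the edge `v (b k)` colour `s k`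
for all `k`. -/
def SpokePattern (X : SimpleGraph V) (H : SimpleGraph VH) (v : V) (b : K → V)
    (s : K → Fin q) : Prop :=
  ∃ c : Sym2 V → Fin q, ¬ HasMonoCopy X H c ∧ ∀ k, c s(v, b k) = s k

lemma exists_star_embedding (v : V) (b : K → V) (hb : Function.Injective b) (hv : ∀ k, b k ≠ v)
    (φ : I → K → W) (hφ : ∀ i, Function.Injective (φ i)) :
    ∃ ψ : I → V ↪ Option (W ⊕ (I × V)), (∀ i, ψ i v = none) ∧
      (∀ i k, ψ i (b k) = some (Sum.inl (φ i k))) ∧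
      ∀ i j, i ≠ j → ∀ x y, ψ i x = ψ j y →
        (x = v ∧ y = v) ∨ ∃ k l, x = b k ∧ y = b l ∧ φ i k = φ j l := by
  classical
  let ψ : I → V → Option (W ⊕ (I × V)) := fun i x =>
    if x = v then none else if h : ∃ k, b k = x then some (Sum.inl (φ i h.choose))
      else some (Sum.inr (i, x))
  have hψv : ∀ i, ψ i v = none := fun i => by simp [ψ]
  have hψb : ∀ i k, ψ i (b k) = some (Sum.inl (φ i k)) := by
    intro i k
    have h : ∃ k', b k' = b k := ⟨k, rfl⟩
    simp only [ψ, hv, if_false, dif_pos h, hb h.choose_spec]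
  have hψ : ∀ i x, x ≠ v → (∀ k, x ≠ b k) → ψ i x = some (Sum.inr (i, x)) := by
    intro i x hx hxb
    have h : ¬ ∃ k, b k = x := by rintro ⟨k, rfl⟩; exact hxb k rfl
    simp only [ψ, hx, if_false, dif_neg h]
  have hcases : ∀ x, x = v ∨ (∃ k, x = b k) ∨ (x ≠ v ∧ ∀ k, x ≠ b k) := by
    intro x
    by_cases hx : x = v
    · exact Or.inl hx
    · by_cases h : ∃ k, x = b k
      · exact Or.inr (Or.inl h)
      · exact Or.inr (Or.inr ⟨hx, by simpa using h⟩)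
  have hcommon : ∀ i j x y, ψ i x = ψ j y → (x = v ∧ y = v) ∨
      (∃ k l, x = b k ∧ y = b l ∧ φ i k = φ j l) ∨ (i = j ∧ x = y) := by
    intro i j x y h
    rcases hcases x with rfl | ⟨k, rfl⟩ | ⟨hx, hx'⟩ <;>
      rcases hcases y with rfl | ⟨l, rfl⟩ | ⟨hy, hy'⟩
    · exact Or.inl ⟨rfl, rfl⟩
    · simp [hψv, hψb] at h
    · simp [hψv, hψ _ _ hy hy'] at h
    · simp [hψv, hψb] at h
    · exact Or.inr (Or.inl ⟨k, l, rfl, rfl, by simpa [hψb] using h⟩)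
    · simp [hψb, hψ _ _ hy hy'] at h
    · simp [hψv, hψ _ _ hx hx'] at h
    · simp [hψb, hψ _ _ hx hx'] at h
    · exact Or.inr (Or.inr (by simpa [hψ _ _ hx hx', hψ _ _ hy hy'] using h))
  refine ⟨fun i => ⟨ψ i, fun x y h => ?_⟩, hψv, hψb, fun i j hij x y h => ?_⟩
  · rcases hcommon i i x y h with ⟨rfl, rfl⟩ | ⟨k, l, rfl, rfl, hkl⟩ | ⟨-, h⟩
    · rfl
    · rw [hφ i hkl]
    · exact h
  · rcases hcommon i j x y h with h | h | h
    · exact Or.inl h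
    · exact Or.inr h
    · exact absurd h.1 hij

/-- Gluing copies of a star-shaped gadget along a sparse hypergraph. -/
lemma exists_star_glue [Fintype VH] (hH : Robust H) (hq : 0 < q) [Finite V] [Finite I] [Finite W]
    (X : SimpleGraph V) (v : V) (b : K → V) (hb : Function.Injective b)
    (hv : ∀ k, X.Adj v (b k)) (φ : I → K → W) (hφ : ∀ i, Function.Injective (φ i)) {g : ℕ}
    (hs : IsSparse g φ) (hg : 2 ≤ g) (hg' : Fintype.card (VH × VH) ≤ g) :
    ∃ (Z : Type) (_ : Finite Z) (Y : SimpleGraph Z) (z : Z) (ι : W → Z),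
      Function.Injective ι ∧ (∀ i k, Y.Adj z (ι (φ i k))) ∧
      (∀ c : Sym2 Z → Fin q, ¬ HasMonoCopy Y H c →
        ∀ i, SpokePattern X H v b (fun k => c s(z, ι (φ i k)))) ∧
      ∀ s : W → Fin q, (∀ i, SpokePattern X H v b (s ∘ φ i)) →
        ∃ c : Sym2 Z → Fin q, ¬ HasMonoCopy Y H c ∧ ∀ i k, c s(z, ι (φ i k)) = s (φ i k) := by
  classical
  obtain ⟨ψ, hψv, hψb, hψ⟩ := exists_star_embedding v b hb (fun k => (hv k).ne') φ hφ
  have hsp : IsSparseGluing (Fintype.card (VH × VH)) fun i => X.map (ψ i) := by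
    intro F h2 hF
    obtain ⟨i, hi, -, -, -, hl, -⟩ := hs F h2 (hF.trans hg')
    refine ⟨i, hi, ?_⟩
    have haux : ∀ x ∈ (X.map (ψ i)).support, ∀ j ∈ F, j ≠ i → x ∈ (X.map (ψ j)).support →
        x = none ∨ ∃ k, SharedAt φ F i k ∧ x = some (Sum.inl (φ i k)) := by
      rintro x ⟨y, hxy⟩ j hj hji ⟨y', hxy'⟩
      obtain ⟨x₁, -, -, rfl, -⟩ := (map_adj _ _ _ _).1 hxy
      obtain ⟨x₂, -, -, hx₂, -⟩ := (map_adj _ _ _ _).1 hxy'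
      rcases hψ j i hji _ _ hx₂ with ⟨-, rfl⟩ | ⟨l, k, -, rfl, hlk⟩
      · exact Or.inl (hψv i)
      · exact Or.inr ⟨k, ⟨j, hj, hji, l, hlk⟩, hψb i k⟩
    by_cases hk : ∃ k, SharedAt φ F i k
    · obtain ⟨k, hk⟩ := hk
      refine ⟨none, some (Sum.inl (φ i k)), fun x hx j hj hji hx' => ?_, Or.inr ⟨?_, ?_⟩⟩
      · rcases haux x hx j hj hji hx' with h | ⟨k', hk', h⟩
        · exact Or.inl h
        · exact Or.inr (by rw [h, hl k k' hk hk'])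
      · exact (map_adj _ _ _ _).2 ⟨v, b k, hv k, hψv i, hψb i k⟩
      · obtain ⟨j, hj, hji, l, hl⟩ := hk
        exact ⟨j, hj, hji, (map_adj _ _ _ _).2 ⟨v, b l, hv l, hψv j, by rw [hψb, hl]⟩⟩
    · refine ⟨none, none, fun x hx j hj hji hx' => ?_, Or.inl rfl⟩
      rcases haux x hx j hj hji hx' with h | ⟨k', hk', -⟩
      · exact Or.inl h
      · exact absurd ⟨k', hk'⟩ hk
  refine ⟨Option (W ⊕ (I × V)), inferInstance, glue (fun _ => X) ψ, none,
    fun w => some (Sum.inl w), fun w w' h => by simpa using h, fun i k => ?_, fun c hc i => ?_,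
    fun s hpat => ?_⟩
  · change (glue _ ψ).Adj none (some (Sum.inl (φ i k)))
    rw [← hψv i, ← hψb]
    exact glue_adj_of_adj (X := fun _ => X) (hv k)
  · refine ⟨fun e => c (e.map (ψ i)), fun h => hc ?_, fun k => ?_⟩
    · exact h.of_hom (ψ i) fun x y hxy => glue_adj_of_adj (X := fun _ => X) hxy
    · simp [hψv, hψb]
  · choose c hc hcs using hpat
    obtain ⟨c', hc', hcc'⟩ := exists_glue_colouring hH hq hsp c hc (by
      intro i j hij x y x' y' hxy hxy' hx hy
      rcases hψ i j hij _ _ hx with ⟨rfl, rfl⟩ | ⟨k, l, rfl, rfl, hkl⟩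
      · rcases hψ i j hij _ _ hy with ⟨rfl, rfl⟩ | ⟨k, l, rfl, rfl, hkl⟩
        · exact absurd rfl hxy.ne
        · rw [hcs, hcs, Function.comp, Function.comp, hkl]
      · rcases hψ i j hij _ _ hy with ⟨rfl, rfl⟩ | ⟨k', l', rfl, rfl, hkl'⟩
        · rw [Sym2.eq_swap, hcs, Sym2.eq_swap, hcs, Function.comp, Function.comp, hkl]
        · rw [(hs.pair hg hφ hij hkl hkl').1] at hxy
          exact absurd rfl hxy.ne)
    refine ⟨c', hc', fun i k => ?_⟩
    have := hcc' i v (b k) (hv k)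
    rw [hψv, hψb, hcs] at this
    exact this

end StarGluing

section InitialGadget

variable {VH : Type} {H : SimpleGraph VH} {q : ℕ}

lemma exists_mono_subset (hq : 0 < q) (k : Fin q → ℕ) :
    ∃ N : ℕ, ∀ (V : Type) (c : Sym2 V → Fin q) (A : Finset V), N ≤ A.card →
      ∃ i, ∃ S ⊆ A, S.card = k i ∧ ∀ x ∈ S, ∀ y ∈ S, x ≠ y → c s(x, y) = i := by
  classical
  induction hm : ∑ i, k i using Nat.strong_induction_on generalizing k with
  | _ m ih =>
  by_cases hk : ∃ i, k i = 0
  · obtain ⟨i, hi⟩ := hk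
    exact ⟨0, fun V c A _ => ⟨i, ∅, by simp, by simp [hi], by simp⟩⟩
  · push Not at hk
    have hlt : ∀ i, ∑ j, Function.update k i (k i - 1) j < m := by
      intro i
      rw [← hm]
      refine Finset.sum_lt_sum (fun j _ => ?_) ⟨i, Finset.mem_univ i, ?_⟩
      · by_cases hj : j = i
        · subst hj
          simp
        · simp [hj]
      · have := hk i
        simp only [Function.update_self]
        omega
    choose N hN using fun i => ih _ (hlt i) (Function.update k i (k i - 1)) rfl
    refine ⟨q * (∑ i, N i) + 1, fun V c A hA => ?_⟩
    obtain ⟨v, hv⟩ := Finset.card_pos.1 (show 0 < A.card by omega)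
    obtain ⟨i, -, hi⟩ := Finset.exists_le_card_fiber_of_mul_le_card_of_maps_to
      (s := A.erase v) (t := (Finset.univ : Finset (Fin q))) (f := fun x => c s(v, x))
      (n := ∑ i, N i) (fun _ _ => Finset.mem_univ _) ⟨⟨0, hq⟩, Finset.mem_univ _⟩ (by
        rw [Finset.card_univ, Fintype.card_fin, Finset.card_erase_of_mem hv]
        omega)
    obtain ⟨j, S, hSA, hS, hSc⟩ := hN i V c _
      ((Finset.single_le_sum (fun i _ => Nat.zero_le (N i)) (Finset.mem_univ i)).trans hi)
    have hSA' : ∀ x ∈ S, x ≠ v ∧ x ∈ A ∧ c s(v, x) = i := by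
      intro x hx
      simpa [and_assoc] using hSA hx
    by_cases hj : j = i
    · subst hj
      refine ⟨j, insert v S, ?_, ?_, ?_⟩
      · exact Finset.insert_subset hv fun x hx => (hSA' x hx).2.1
      · rw [Finset.card_insert_of_notMem fun h => (hSA' v h).1 rfl, hS]
        have := hk j
        simp only [Function.update_self]
        omega
      · intro x hx y hy hxy
        rcases Finset.mem_insert.1 hx with rfl | hx' <;>
          rcases Finset.mem_insert.1 hy with rfl | hy'
        · exact absurd rfl hxy
        · exact (hSA' y hy').2.2
        · rw [Sym2.eq_swap]
          exact (hSA' x hx').2.2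
        · exact hSc x hx' y hy' hxy
    · exact ⟨j, S, fun x hx => (hSA' x hx).2.1, by simpa [hj] using hS, hSc⟩

lemma exists_top_isRamsey [Fintype VH] (H : SimpleGraph VH) (hq : 0 < q) :
    ∃ N, IsRamsey q (⊤ : SimpleGraph (Fin N)) H := by
  obtain ⟨N, hN⟩ := exists_mono_subset hq fun _ => Fintype.card VH
  refine ⟨N, fun c => ?_⟩
  obtain ⟨i, S, -, hS, hc⟩ := hN (Fin N) c Finset.univ (by simp)
  obtain ⟨e⟩ := Function.Embedding.nonempty_of_card_le (α := VH) (β := S) (by simp [hS])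
  refine ⟨i, e.trans (Function.Embedding.subtype _), fun a b hab => ?_⟩
  have hne : (e a : Fin N) ≠ e b := fun h => hab.ne (e.injective (Subtype.ext h))
  exact ⟨hne, hc _ (e a).2 _ (e b).2 hne⟩

/-- The complete graph on `V` together with a new vertex `none` joined to the vertices in `S`. -/
def coneOver {V : Type} (S : Finset V) : SimpleGraph (Option V) where
  Adj x y := x ≠ y ∧ (x = none → ∃ a ∈ S, y = some a) ∧ (y = none → ∃ a ∈ S, x = some a)
  symm := ⟨fun _ _ h => ⟨h.1.symm, h.2.2, h.2.1⟩⟩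
  loopless := ⟨fun _ h => h.1 rfl⟩

/-- There is a star-shaped gadget whose edges at the centre cannot all have the same colour. -/
lemma exists_nonconstant_gadget [Fintype VH] (hH : Robust H) (hq : 2 ≤ q) :
    ∃ (V K : Type) (_ : Finite V) (_ : Finite K) (X : SimpleGraph V) (v : V) (b : K → V),
      Function.Injective b ∧ (∀ k, X.Adj v (b k)) ∧ (∃ s : K → Fin q, SpokePattern X H v b s) ∧
      ∀ s : K → Fin q, SpokePattern X H v b s → ¬ ∀ k k', s k = s k' := by
  classical
  have : Nontrivial (Fin q) := Fin.nontrivial_iff_two_le.2 hq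
  have hex := exists_top_isRamsey H (q := q) (by omega)
  obtain ⟨n, hn⟩ : ∃ n, Nat.find hex = n + 1 := by
    refine Nat.exists_eq_succ_of_ne_zero fun h0 => ?_
    have h := Nat.find_spec hex
    rw [h0] at h
    obtain ⟨_, f, -⟩ := h fun _ => ⟨0, by omega⟩
    obtain ⟨a, -, -⟩ := hH.exists_adj
    exact (f a).elim0
  have hR := Nat.find_spec hex
  rw [hn] at hR
  have hnR := Nat.find_min hex (m := n) (by omega)
  unfold IsRamsey at hnR
  push Not at hnR
  obtain ⟨c₀, hc₀⟩ := hnR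
  obtain ⟨S, a, ha, ⟨c, hc, t, ht⟩, hS'⟩ := Finset.exists_insert_step
    (fun S : Finset (Fin n) => ∃ c : Sym2 (Option (Fin n)) → Fin q,
      ¬ HasMonoCopy (coneOver S) H c ∧ ∃ t, ∀ a ∈ S, c s(none, some a) = t)
    (by
      refine ⟨Function.extend (Sym2.map some) c₀ fun _ => ⟨0, by omega⟩, ?_, ⟨0, by omega⟩, by simp⟩
      rintro ⟨i, f, hf⟩
      have hlift : ∀ a, ∃ x, some x = f a := by
        intro a
        obtain ⟨b, -, hab⟩ := hH.exists_adj_ne a a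
        rw [← Option.ne_none_iff_exists]
        intro h
        simpa using (hf a b hab).1.2.1 h
      choose g hg using hlift
      refine hc₀ ⟨i, ⟨g, fun a b hab => f.injective (by rw [← hg, ← hg, hab])⟩, fun a b hab => ?_⟩
      obtain ⟨h, h'⟩ := hf a b hab
      rw [← hg, ← hg] at h h'
      refine ⟨fun e => h.1 (congrArg some e), ?_⟩
      rwa [← Sym2.map_mk,
        (Sym2.map.injective (Option.some_injective _)).extend_apply] at h')
    (T := Finset.univ) (by
      rintro ⟨c, hc, -⟩
      refine hc (HasMonoCopy.of_hom (finSuccEquiv n).toEmbedding (fun x y hxy => ?_) (hR _))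
      have hne : finSuccEquiv n x ≠ finSuccEquiv n y := fun h => hxy ((finSuccEquiv n).injective h)
      refine ⟨hne, fun h => ?_, fun h => ?_⟩
      · obtain ⟨a, ha⟩ := Option.ne_none_iff_exists'.1 (h ▸ hne).symm
        exact ⟨a, Finset.mem_univ a, ha⟩
      · obtain ⟨a, ha⟩ := Option.ne_none_iff_exists'.1 (h ▸ hne)
        exact ⟨a, Finset.mem_univ a, ha⟩)
  obtain ⟨t', ht'⟩ := exists_ne t
  refine ⟨Option (Fin n), {x // x ∈ insert a S}, inferInstance, inferInstance,
    coneOver (insert a S), none, fun k => some k, fun x y h => Subtype.ext (Option.some.inj h),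
    fun k => ⟨by simp, fun _ => ⟨k, k.2, rfl⟩, by simp⟩, ?_, ?_⟩
  · let c' := Function.update c s(none, some a) t'
    refine ⟨fun k => c' s(none, some k), c', ?_, fun k => rfl⟩
    rintro ⟨i, f, hf⟩
    have hunused : ∀ x y, H.Adj x y → f x = none → f y ≠ some a := by
      intro x y hxy hx hy
      obtain ⟨z, hzy, hxz⟩ := hH.exists_adj_ne x y
      have h1 := (hf x y hxy).2
      obtain ⟨⟨-, hz, -⟩, h2⟩ := hf x z hxz
      obtain ⟨d, hd, hdz⟩ := hz hx
      have hda : d ≠ a := by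
        rintro rfl
        exact hzy (f.injective (hdz.trans hy.symm))
      rw [hx, hy] at h1
      rw [hx, hdz] at h2
      have hd' := ht d (Finset.mem_of_mem_insert_of_ne hd hda)
      simp only [c', Function.update_self] at h1
      rw [show c' s(none, some d) = c s(none, some d) from
        Function.update_of_ne (by simpa using hda) _ _, hd'] at h2
      exact ht' (h1.trans h2.symm)
    refine hc ⟨i, f, fun x y hxy => ?_⟩
    obtain ⟨⟨h₁, h₂, h₃⟩, h₄⟩ := hf x y hxy
    refine ⟨⟨h₁, fun h => ?_, fun h => ?_⟩, ?_⟩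
    · obtain ⟨d, hd, hdy⟩ := h₂ h
      refine ⟨d, Finset.mem_of_mem_insert_of_ne hd ?_, hdy⟩
      rintro rfl
      exact hunused x y hxy h hdy
    · obtain ⟨d, hd, hdy⟩ := h₃ h
      refine ⟨d, Finset.mem_of_mem_insert_of_ne hd ?_, hdy⟩
      rintro rfl
      exact hunused y x hxy.symm h hdy
    · rw [← h₄]
      refine (Function.update_of_ne (fun e => ?_) _ _).symm
      rcases Sym2.eq_iff.1 e with ⟨e₁, e₂⟩ | ⟨e₁, e₂⟩
      · exact hunused x y hxy e₁ e₂
      · exact hunused y x hxy.symm e₂ e₁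
  · rintro s ⟨c, hc, hcs⟩ hconst
    exact hS' ⟨c, hc, s ⟨a, Finset.mem_insert_self a S⟩, fun d hd =>
      (hcs ⟨d, hd⟩).trans (hconst _ _)⟩

end InitialGadget

section Senders

variable {VH V V₁ V₂ : Type} {H : SimpleGraph VH} {q : ℕ}

lemma Equiv.Perm.exists_apply_eq_pair {α : Type*} {x y x' y' : α} (h : x ≠ y) (h' : x' ≠ y') :
    ∃ σ : Equiv.Perm α, σ x = x' ∧ σ y = y' := by
  classical
  refine ⟨(Equiv.swap x x').trans (Equiv.swap (Equiv.swap x x' y) y'), ?_, by simp⟩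
  rw [Equiv.trans_apply, Equiv.swap_apply_left]
  refine Equiv.swap_apply_of_ne_of_ne (fun e => h ?_) h'
  exact (Equiv.swap x x').injective (by rw [Equiv.swap_apply_left, ← e])

lemma HasMonoCopy.of_perm {X : SimpleGraph V} (σ : Equiv.Perm (Fin q)) {c : Sym2 V → Fin q}
    (h : HasMonoCopy X H (fun e => σ (c e))) : HasMonoCopy X H c := by
  obtain ⟨i, f, hf⟩ := h
  exact ⟨σ.symm i, f, fun a b hab =>
    ⟨(hf a b hab).1, by rw [← (hf a b hab).2, Equiv.symm_apply_apply]⟩⟩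

/-- Some finite graph has two edges at a common vertex whose colours are related by `r` in every
colouring without monochromatic copy of `H`. -/
def HasRelatedPair (q : ℕ) (H : SimpleGraph VH) (r : Fin q → Fin q → Prop) : Prop :=
  ∃ (V : Type) (_ : Finite V) (X : SimpleGraph V) (v a b : V), a ≠ b ∧ X.Adj v a ∧ X.Adj v b ∧
    (∃ c : Sym2 V → Fin q, ¬ HasMonoCopy X H c) ∧
    ∀ c : Sym2 V → Fin q, ¬ HasMonoCopy X H c → r (c s(v, a)) (c s(v, b))

lemma hasRelatedPair_ne [Fintype VH] (hH : Robust H) (hq : 2 ≤ q) :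
    HasRelatedPair q H (· ≠ ·) := by
  obtain ⟨V, K, _, _, X, v, b, hb, hv, hT, hconst⟩ := exists_nonconstant_gadget hH hq
  obtain ⟨W, I, _, _, φ, x, y, hφ, hs, ⟨i, k, rfl⟩, ⟨j, l, rfl⟩, ⟨s, hsat⟩, hne⟩ :=
    exists_sparse_forced_ne (by omega) (max 2 (Fintype.card (VH × VH)))
      (SpokePattern X H v b) hT hconst
  obtain ⟨Z, hZ, Y, z, ι, hι, hadj, hres, hext⟩ := exists_star_glue hH (q := q) (by omega) X v b
    hb hv φ hφ hs (le_max_left _ _) (le_max_right _ _)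
  obtain ⟨c, hc, -⟩ := hext s hsat
  refine ⟨Z, hZ, Y, z, ι (φ i k), ι (φ j l), fun h => ?_, hadj i k, hadj j l, ⟨c, hc⟩,
    fun c hc => hne (fun w => c s(z, ι w)) (hres c hc)⟩
  exact hne s hsat (congrArg s (hι h))

lemma hasRelatedPair_eq [Fintype VH] (hH : Robust H) (hq : 2 ≤ q) :
    HasRelatedPair q H (· = ·) := by
  obtain ⟨V, _, X, v, a, b, hab, hva, hvb, ⟨c₀, hc₀⟩, hne⟩ := hasRelatedPair_ne hH hq
  have hpat : ∀ s : Bool → Fin q,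
      SpokePattern X H v (fun k => cond k b a) s ↔ s false ≠ s true := by
    refine fun s => ⟨?_, fun h => ?_⟩
    · rintro ⟨c, hc, hcs⟩
      rw [← hcs, ← hcs]
      exact hne c hc
    · obtain ⟨σ, h₁, h₂⟩ := Equiv.Perm.exists_apply_eq_pair (hne c₀ hc₀) h
      refine ⟨fun e => σ (c₀ e), fun h => hc₀ h.of_perm, ?_⟩
      rintro (_ | _)
      · exact h₁
      · exact h₂
  obtain ⟨W, I, _, _, φ, x, y, hφ, hs, hxy, ⟨i, k, rfl⟩, ⟨j, l, rfl⟩, ⟨s, hsat⟩, heq⟩ :=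
    exists_sparse_forced_eq hq (max 2 (Fintype.card (VH × VH)))
  obtain ⟨Z, hZ, Y, z, ι, hι, hadj, hres, hext⟩ := exists_star_glue hH (q := q) (by omega) X v
    (fun k => cond k b a) (by
      rintro (_ | _) (_ | _) h
      · rfl
      · exact absurd h hab
      · exact absurd h.symm hab
      · rfl) (by
      rintro (_ | _)
      · exact hva
      · exact hvb) φ hφ hs (le_max_left _ _) (le_max_right _ _)
  obtain ⟨c, hc, -⟩ := hext s fun i => (hpat _).2 (hsat i)
  exact ⟨Z, hZ, Y, z, ι (φ i k), ι (φ j l), fun h => hxy (hι h), hadj i k, hadj j l, ⟨c, hc⟩,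
    fun c hc => heq (fun w => c s(z, ι w)) fun i => (hpat _).1 (hres c hc i)⟩

lemma exists_two_sum_embedding {x₁ y₁ : V₁} {x₂ y₂ : V₂} (h₁ : x₁ ≠ y₁) (h₂ : x₂ ≠ y₂) :
    ∃ β : V₂ ↪ V₁ ⊕ V₂, β x₂ = Sum.inl x₁ ∧ β y₂ = Sum.inl y₁ ∧
      ∀ p, (p = x₂ ∨ p = y₂) ∨ β p = Sum.inr p := by
  classical
  let β : V₂ → V₁ ⊕ V₂ := fun p =>
    if p = x₂ then Sum.inl x₁ else if p = y₂ then Sum.inl y₁ else Sum.inr p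
  have hx : β x₂ = Sum.inl x₁ := by simp [β]
  have hy : β y₂ = Sum.inl y₁ := by simp [β, h₂.symm]
  have hβ : ∀ p, (p = x₂ ∨ p = y₂) ∨ β p = Sum.inr p := by
    intro p
    by_cases hx : p = x₂
    · exact Or.inl (Or.inl hx)
    · by_cases hy : p = y₂
      · exact Or.inl (Or.inr hy)
      · exact Or.inr (by simp [β, hx, hy])
  refine ⟨⟨β, fun p r h => ?_⟩, hx, hy, hβ⟩
  rcases hβ p with (rfl | rfl) | hp <;> rcases hβ r with (rfl | rfl) | hr <;> simp_all

/-- Gluing two graphs along an edge. -/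
lemma exists_two_sum [Fintype VH] (hH : Robust H) [Finite V₁] [Finite V₂]
    {X₁ : SimpleGraph V₁} {X₂ : SimpleGraph V₂} {x₁ y₁ : V₁} {x₂ y₂ : V₂}
    (h₁ : X₁.Adj x₁ y₁) (h₂ : X₂.Adj x₂ y₂)
    (hc₁ : ∃ c : Sym2 V₁ → Fin q, ¬ HasMonoCopy X₁ H c)
    (hc₂ : ∃ c : Sym2 V₂ → Fin q, ¬ HasMonoCopy X₂ H c) :
    ∃ (Z : Type) (_ : Finite Z) (Y : SimpleGraph Z) (α : V₁ ↪ Z) (β : V₂ ↪ Z),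
      α x₁ = β x₂ ∧ α y₁ = β y₂ ∧
      (∀ x y, X₁.Adj x y → Y.Adj (α x) (α y)) ∧ (∀ x y, X₂.Adj x y → Y.Adj (β x) (β y)) ∧
      (∃ c : Sym2 Z → Fin q, ¬ HasMonoCopy Y H c) ∧
      ∀ (l₁ : V₁ → ℕ) (l₂ : V₂ → ℕ), (∀ x y, X₁.Adj x y → l₁ x ≤ l₁ y + 1) →
        (∀ x y, X₂.Adj x y → l₂ x ≤ l₂ y + 1) → l₁ x₁ = l₂ x₂ → l₁ y₁ = l₂ y₂ →
        ∃ l : Z → ℕ, (∀ x, l (α x) = l₁ x) ∧ (∀ x, l (β x) = l₂ x) ∧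
          ∀ x y, Y.Adj x y → l x ≤ l y + 1 := by
  classical
  obtain ⟨β, hβx, hβy, hβ⟩ := exists_two_sum_embedding h₁.ne h₂.ne
  have hcommon : ∀ p r, Sum.inl p = β r → (p = x₁ ∧ r = x₂) ∨ (p = y₁ ∧ r = y₂) := by
    intro p r h
    rcases hβ r with (rfl | rfl) | hr
    · exact Or.inl ⟨Sum.inl.inj (h.trans hβx), rfl⟩
    · exact Or.inr ⟨Sum.inl.inj (h.trans hβy), rfl⟩
    · simp [hr] at h
  let V : Bool → Type := fun b => cond b V₁ V₂
  let X : ∀ b, SimpleGraph (V b) := Bool.rec X₂ X₁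
  let ψ : ∀ b, V b ↪ V₁ ⊕ V₂ := Bool.rec β Function.Embedding.inl
  have hsp : IsSparseGluing (Fintype.card (VH × VH)) fun i => (X i).map (ψ i) := by
    intro F h2 _
    have hF : F = Finset.univ := by
      rw [← Finset.card_eq_iff_eq_univ]
      exact le_antisymm (Finset.card_le_univ F) h2
    subst hF
    refine ⟨true, Finset.mem_univ _, Sum.inl x₁, Sum.inl y₁, ?_, Or.inr ⟨?_, false, by simp,
      by simp, ?_⟩⟩
    · rintro x ⟨y, hxy⟩ (_ | _) - hj ⟨y', hxy'⟩
      · obtain ⟨p, -, -, rfl, -⟩ := (map_adj _ _ _ _).1 hxy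
        obtain ⟨r, -, -, hr, -⟩ := (map_adj _ _ _ _).1 hxy'
        rcases hcommon p r hr.symm with ⟨rfl, -⟩ | ⟨rfl, -⟩
        · exact Or.inl rfl
        · exact Or.inr rfl
      · exact absurd rfl hj
    · exact (map_adj _ _ _ _).2 ⟨x₁, y₁, h₁, rfl, rfl⟩
    · exact (map_adj _ _ _ _).2 ⟨x₂, y₂, h₂, hβx, hβy⟩
  obtain ⟨c₁, hc₁⟩ := hc₁
  obtain ⟨c₂, hc₂⟩ := hc₂
  let σ := Equiv.swap (c₂ s(x₂, y₂)) (c₁ s(x₁, y₁))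
  let c : ∀ b, Sym2 (V b) → Fin q := Bool.rec (fun e => σ (c₂ e)) c₁
  have hσ : c₁ s(x₁, y₁) = σ (c₂ s(x₂, y₂)) := (Equiv.swap_apply_left _ _).symm
  have hagree : ∀ p p' r r', X₁.Adj p p' → Sum.inl p = β r → Sum.inl p' = β r' →
      c₁ s(p, p') = σ (c₂ s(r, r')) := by
    intro p p' r r' hadj hp hp'
    rcases hcommon p r hp with ⟨rfl, rfl⟩ | ⟨rfl, rfl⟩ <;>
      rcases hcommon p' r' hp' with ⟨rfl, rfl⟩ | ⟨rfl, rfl⟩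
    · exact absurd rfl hadj.ne
    · exact hσ
    · rw [Sym2.eq_swap, hσ, Sym2.eq_swap]
    · exact absurd rfl hadj.ne
  obtain ⟨c', hc', -⟩ := exists_glue_colouring hH ((Nat.zero_le _).trans_lt (c₁ s(x₁, y₁)).2) hsp c
    (by
      rintro (_ | _)
      · exact fun h => hc₂ h.of_perm
      · exact hc₁)
    (by
      rintro (_ | _) (_ | _) hij x y x' y' hxy hxy' hx hy
      · exact absurd rfl hij
      · exact (hagree _ _ _ _ hxy' hx.symm hy.symm).symm
      · exact hagree _ _ _ _ hxy hx hy
      · exact absurd rfl hij)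
  refine ⟨V₁ ⊕ V₂, inferInstance, glue X ψ, Function.Embedding.inl, β, hβx.symm, hβy.symm,
    fun x y h => glue_adj_of_adj (X := X) (ψ := ψ) (i := true) h,
    fun x y h => glue_adj_of_adj (X := X) (ψ := ψ) (i := false) h, ⟨c', hc'⟩,
    fun l₁ l₂ hl₁ hl₂ hx hy => ?_⟩
  have hlβ : ∀ p, Sum.elim l₁ l₂ (β p) = l₂ p := by
    intro p
    rcases hβ p with (rfl | rfl) | hp
    · rw [hβx, Sum.elim_inl, hx]
    · rw [hβy, Sum.elim_inl, hy]
    · rw [hp, Sum.elim_inr]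
  refine ⟨Sum.elim l₁ l₂, fun x => rfl, hlβ, fun x y h => ?_⟩
  obtain ⟨_ | _, p, r, hpr, rfl, rfl⟩ := glue_adj.1 h
  · change Sum.elim l₁ l₂ (β p) ≤ Sum.elim l₁ l₂ (β r) + 1
    rw [hlβ, hlβ]
    exact hl₂ _ _ hpr
  · exact hl₁ _ _ hpr

/-- Some finite graph has edges `e₁e₂` and `f₁f₂` whose colours are related by `r` in every
colouring without monochromatic copy of `H`, and which are at distance at least `d`, as witnessed
by the function `l`. -/
def HasSender (q : ℕ) (H : SimpleGraph VH) (r : Fin q → Fin q → Prop) (d : ℕ) : Prop :=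
  ∃ (V : Type) (_ : Finite V) (X : SimpleGraph V) (e₁ e₂ f₁ f₂ : V) (l : V → ℕ),
    X.Adj e₁ e₂ ∧ X.Adj f₁ f₂ ∧ (∃ c : Sym2 V → Fin q, ¬ HasMonoCopy X H c) ∧
    (∀ c : Sym2 V → Fin q, ¬ HasMonoCopy X H c → r (c s(e₁, e₂)) (c s(f₁, f₂))) ∧
    (∀ x y, X.Adj x y → l x ≤ l y + 1) ∧ (l e₁ = 0 ∧ l e₂ = 0) ∧ l f₁ = d ∧ l f₂ = d

lemma HasRelatedPair.hasSender_zero {r : Fin q → Fin q → Prop} (h : HasRelatedPair q H r) :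
    HasSender q H r 0 := by
  obtain ⟨V, hV, X, v, a, b, -, hva, hvb, hc, hr⟩ := h
  exact ⟨V, hV, X, v, a, v, b, fun _ => 0, hva, hvb, hc, hr, by simp⟩

lemma HasRelatedPair.hasSender_one [Fintype VH] (hH : Robust H)
    (h : HasRelatedPair q H (· = ·)) : HasSender q H (· = ·) 1 := by
  classical
  obtain ⟨V, _, X, v, a, b, hab, hva, hvb, hc, hr⟩ := h
  obtain ⟨Z, hZ, Y, α, β, hx, hy, hα, hβ, hY, hl⟩ := exists_two_sum hH hvb hva.symm hc hc
  obtain ⟨l, hlα, hlβ, hl⟩ := hl (fun x => if x = v ∨ x = a then 0 else 1)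
    (fun x => if x = a then 0 else 1)
    (fun x y _ => by split_ifs <;> omega)
    (fun x y _ => by split_ifs <;> omega) (by simp)
    (by simp [hab.symm, hvb.ne', hva.ne])
  refine ⟨Z, hZ, Y, α v, α a, β v, β b, l, hα _ _ hva, hβ _ _ hvb, hY, fun c hcY => ?_, hl,
    ⟨by simp [hlα], by simp [hlα]⟩, by simp [hlβ, hva.ne], by simp [hlβ, hab.symm]⟩
  have k₁ := hr (fun e => c (e.map α)) fun h => hcY (h.of_hom α hα)
  have k₂ := hr (fun e => c (e.map β)) fun h => hcY (h.of_hom β hβ)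
  simp only [Sym2.map_mk] at k₁ k₂
  rw [← k₂, k₁, hx, hy, Sym2.eq_swap]

lemma HasSender.trans [Fintype VH] (hH : Robust H) {r : Fin q → Fin q → Prop} {d d' : ℕ}
    (h : HasSender q H r d) (h' : HasSender q H (· = ·) d') : HasSender q H r (d + d') := by
  obtain ⟨V, _, X, e₁, e₂, f₁, f₂, l, he, hf, hc, hr, hl, ⟨hl₁, hl₂⟩, hl₃, hl₄⟩ := h
  obtain ⟨V', _, X', e₁', e₂', f₁', f₂', l', he', hf', hc', hr', hl', ⟨hl₁', hl₂'⟩, hl₃', hl₄'⟩ :=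
    h'
  obtain ⟨Z, hZ, Y, α, β, hx, hy, hα, hβ, hY, hlip⟩ := exists_two_sum hH hf he' hc hc'
  obtain ⟨L, hLα, hLβ, hL⟩ := hlip l (fun x => d + l' x) hl
    (fun x y hxy => by have := hl' x y hxy; omega) (by simp [hl₃, hl₁']) (by simp [hl₄, hl₂'])
  refine ⟨Z, hZ, Y, α e₁, α e₂, β f₁', β f₂', L, hα _ _ he, hβ _ _ hf', hY, fun c hcY => ?_, hL,
    ⟨by rw [hLα, hl₁], by rw [hLα, hl₂]⟩, by rw [hLβ, hl₃'], by rw [hLβ, hl₄']⟩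
  have k₁ := hr (fun e => c (e.map α)) fun h => hcY (h.of_hom α hα)
  have k₂ := hr' (fun e => c (e.map β)) fun h => hcY (h.of_hom β hβ)
  simp only [Sym2.map_mk] at k₁ k₂
  rwa [← k₂, ← hx, ← hy]

lemma hasSender_eq [Fintype VH] (hH : Robust H) (hq : 2 ≤ q) (d : ℕ) :
    HasSender q H (· = ·) (d + 1) := by
  have h₁ := (hasRelatedPair_eq hH hq).hasSender_one hH
  induction d with
  | zero => exact h₁
  | succ d ih => exact ih.trans hH h₁

lemma SimpleGraph.Walk.le_add_length {X : SimpleGraph V} {l : V → ℕ}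
    (hl : ∀ x y, X.Adj x y → l x ≤ l y + 1) {u v : V} (p : X.Walk u v) :
    l v ≤ l u + p.length := by
  induction p with
  | nil => simp
  | cons h p ih =>
    have := hl _ _ h.symm
    rw [Walk.length_cons]
    omega

lemma HasSender.exists_fin {r : Fin q → Fin q → Prop} {d : ℕ} (h : HasSender q H r d) :
    ∃ (n : ℕ) (S : SimpleGraph (Fin n)) (e₁ e₂ f₁ f₂ : Fin n),
      S.Adj e₁ e₂ ∧ S.Adj f₁ f₂ ∧
      ¬ IsRamsey q S H ∧
      (∀ c : Sym2 (Fin n) → Fin q, ¬ HasMonoCopy S H c → r (c s(e₁, e₂)) (c s(f₁, f₂))) ∧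
      (∀ u v : Fin n, (u = e₁ ∨ u = e₂) → (v = f₁ ∨ v = f₂) →
        ∀ p : S.Walk u v, d ≤ p.length) := by
  obtain ⟨V, _, X, e₁, e₂, f₁, f₂, l, he, hf, ⟨c₀, hc₀⟩, hr, hl, ⟨hl₁, hl₂⟩, hl₃, hl₄⟩ := h
  let ε := Finite.equivFin V
  refine ⟨Nat.card V, X.comap ε.symm, ε e₁, ε e₂, ε f₁, ε f₂, by simpa using he, by simpa using hf,
    fun h => hc₀ ?_, fun c hc => ?_, fun u v hu hv p => ?_⟩
  · exact HasMonoCopy.of_hom ε.symm.toEmbedding (fun x y hxy => hxy) (h _)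
  · exact hr (fun e => c (e.map ε)) fun h =>
      hc (HasMonoCopy.of_hom ε.toEmbedding (fun x y hxy => by simpa using hxy) h)
  · have := p.le_add_length (l := fun x => l (ε.symm x)) fun x y hxy => hl _ _ hxy
    have hu' : l (ε.symm u) = 0 := by rcases hu with rfl | rfl <;> simp [hl₁, hl₂]
    have hv' : l (ε.symm v) = d := by rcases hv with rfl | rfl <;> simp [hl₃, hl₄]
    omega

end Senders

/-- If `H` is 3-connected or a triangle and `q, d ≥ 2`, then negative
and positive signal senders `S⁻(q,H,d)` and `S⁺(q,H,d)` exist: graphs `S` with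
distinguished edges `e = e₁e₂` and `f = f₁f₂` such that (S1) `S` is not `q`-Ramsey for
`H`; (S2) in every `H`-free `q`-colouring of `S` the edges `e` and `f` get different
(resp. equal) colours; (S3) every path between an endpoint of `e` and an endpoint of `f`
has length at least `d`. -/
theorem stmt10 {VH : Type} [Fintype VH]
    (H : SimpleGraph VH) (hH : ThreeConnOrK3 H)
    (q d : ℕ) (hq : 2 ≤ q) (hd : 2 ≤ d) :
    (∃ (n : ℕ) (S : SimpleGraph (Fin n)) (e₁ e₂ f₁ f₂ : Fin n),
      S.Adj e₁ e₂ ∧ S.Adj f₁ f₂ ∧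
      ¬ IsRamsey q S H ∧
      (∀ c : Sym2 (Fin n) → Fin q, ¬ HasMonoCopy S H c → c s(e₁, e₂) ≠ c s(f₁, f₂)) ∧
      (∀ u v : Fin n, (u = e₁ ∨ u = e₂) → (v = f₁ ∨ v = f₂) →
        ∀ p : S.Walk u v, d ≤ p.length)) ∧
    (∃ (n : ℕ) (S : SimpleGraph (Fin n)) (e₁ e₂ f₁ f₂ : Fin n),
      S.Adj e₁ e₂ ∧ S.Adj f₁ f₂ ∧
      ¬ IsRamsey q S H ∧
      (∀ c : Sym2 (Fin n) → Fin q, ¬ HasMonoCopy S H c → c s(e₁, e₂) = c s(f₁, f₂)) ∧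
      (∀ u v : Fin n, (u = e₁ ∨ u = e₂) → (v = f₁ ∨ v = f₂) →
        ∀ p : S.Walk u v, d ≤ p.length)) := by
  obtain ⟨d, rfl⟩ : ∃ k, d = k + 1 := ⟨d - 1, by omega⟩
  have h := hasSender_eq hH.robust hq d
  have h' := (hasRelatedPair_ne hH.robust hq).hasSender_zero.trans hH.robust h
  rw [zero_add] at h'
  exact ⟨h'.exists_fin, h.exists_fin⟩
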